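/- Let P be a transition kernel on S, let F ⊆ {1,…,H}×S×A×S, and let P̃ be the associated absorbing MDP on S ∪ {s†}. Then for every policy π on S and every h ∈ {1,…,H}, the probability under (π,P) that the trajectory (s_1,a_1,…,s_H,a_H,s_{H+1}) satisfies (h,s_h,a_h,s_{h+1}) ∈ F and (h',s_{h'},a_{h'},s_{h'+1}) ∉ F for all h' < h equals ∑_{s∈S} ∑_{a∈A} d^{π,P̃}_h(s) · π_h(a|s) · P̃_h(s†|s,a); consequently, the probability under (π,P) that the trajectory contains some tuple (h,s_h,a_h,s_{h+1}) ∈ F equals d^{π,P̃}_{H+1}(s†). -/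

import Mathlib

/-- The state-visitation distribution `d^{π,P}` of a policy `π` and transition
kernel `P` in a finite-horizon MDP with initial state `s₁` (0-based step). -/
def visit {X A : Type*} [Fintype X] [Fintype A] [DecidableEq X] (s₁ : X)
    (π : ℕ → X → A → ℝ) (P : ℕ → X → A → X → ℝ) : ℕ → X → ℝ
  | 0 => fun x => if x = s₁ then 1 else 0
  | h + 1 => fun x' => ∑ x : X, ∑ a : A, visit s₁ π P h x * π h x a * P h x a x'

open Classical in
/-- The absorbing MDP `P̃` on `S ⊕ {s†}` associated with a transition kernel
`P` on `S` and a set of infrequent tuples `F`. -/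
noncomputable def absorb {S A : Type*} [Fintype S]
    (P : ℕ → S → A → S → ℝ) (F : Set (ℕ × S × A × S)) :
    ℕ → S ⊕ Unit → A → S ⊕ Unit → ℝ :=
  fun h x a x' =>
    match x, x' with
    | Sum.inl s, Sum.inl s' => if (h, s, a, s') ∈ F then 0 else P h s a s'
    | Sum.inl s, Sum.inr _ => ∑ s' : S, if (h, s, a, s') ∈ F then P h s a s' else 0
    | Sum.inr _, Sum.inl _ => 0
    | Sum.inr _, Sum.inr _ => 1

/-- The probability under `(π,P)` of the trajectory
`(s_1,a_1,…,s_H,a_H,s_{H+1})` (0-indexed: `τ.1 h` is the state at 1-based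
step `h+1`, `τ.2 h` the action), starting from `s₁`. -/
noncomputable def trajProb {S A : Type*} [Fintype S] [Fintype A] [DecidableEq S]
    (H : ℕ) (s₁ : S) (π : ℕ → S → A → ℝ) (P : ℕ → S → A → S → ℝ)
    (τ : (Fin (H + 1) → S) × (Fin H → A)) : ℝ :=
  (if τ.1 0 = s₁ then 1 else 0) *
    ∏ h : Fin H,
      π h (τ.1 h.castSucc) (τ.2 h) * P h (τ.1 h.castSucc) (τ.2 h) (τ.1 h.succ)

lemma path_sum {S A : Type*} [Fintype S] [Fintype A] [DecidableEq S] (s₁ : S)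
    (G : ℕ → S → A → S → ℝ) (H : ℕ) : ∀ g : S → ℝ,
    (∑ τ : (Fin (H + 1) → S) × (Fin H → A),
      ((if τ.1 0 = s₁ then 1 else 0) *
        ∏ h : Fin H, G h (τ.1 h.castSucc) (τ.2 h) (τ.1 h.succ)) * g (τ.1 (Fin.last H)))
      = ∑ x, visit s₁ (fun _ _ _ => 1) G H x * g x := by
  induction H with
  | zero =>
    intro g
    rw [Fintype.sum_prod_type]
    rw [← (Equiv.funUnique (Fin 1) S).symm.sum_comp]
    simp [visit]
  | succ n ih =>
    intro g
    have key := ih (fun x => ∑ a, ∑ x', G n x a x' * g x')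
    have e : (∑ x, visit s₁ (fun _ _ _ => 1) G (n+1) x * g x)
        = ∑ x, visit s₁ (fun _ _ _ => 1) G n x * ∑ a, ∑ x', G n x a x' * g x' := by
      simp only [visit, Finset.sum_mul, Finset.mul_sum, mul_one]
      rw [Finset.sum_comm]
      refine Finset.sum_congr rfl fun x _ => ?_
      rw [Finset.sum_comm]
      refine Finset.sum_congr rfl fun x _ => ?_
      refine Finset.sum_congr rfl fun x _ => ?_
      ring
    rw [e, ← key, Fintype.sum_prod_type, Fintype.sum_prod_type]
    rw [← (Fin.snocEquiv (fun _ : Fin (n+2) => S)).sum_comp, Fintype.sum_prod_type,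
      Finset.sum_comm]
    refine Finset.sum_congr rfl fun σ _ => ?_
    have : ∀ x' : S, (∑ α : Fin (n+1) → A,
      ((if (Fin.snocEquiv (fun _ : Fin (n+2) => S) (x', σ)) 0 = s₁ then (1:ℝ) else 0) *
        ∏ h : Fin (n+1), G h ((Fin.snocEquiv (fun _ : Fin (n+2) => S) (x', σ)) h.castSucc) (α h)
          ((Fin.snocEquiv (fun _ : Fin (n+2) => S) (x', σ)) h.succ)) *
          g ((Fin.snocEquiv (fun _ : Fin (n+2) => S) (x', σ)) (Fin.last (n+1))))
        = ∑ a, ∑ α : Fin n → A, ((if σ 0 = s₁ then 1 else 0) *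
          ∏ h : Fin n, G h (σ h.castSucc) (α h) (σ h.succ)) *
            (G n (σ (Fin.last n)) a x' * g x') := by
      intro x'
      rw [← (Fin.snocEquiv (fun _ : Fin (n+1) => A)).sum_comp, Fintype.sum_prod_type]
      refine Finset.sum_congr rfl fun a _ => Finset.sum_congr rfl fun α _ => ?_
      rw [Fin.prod_univ_castSucc]
      have h0 : (Fin.snoc σ x' : Fin (n+2) → S) 0 = σ 0 := by
        have := Fin.snoc_castSucc (α := fun _ : Fin (n+2) => S) x' σ 0
        simpa using this
      simp only [Fin.snocEquiv, Equiv.coe_fn_mk, h0, Fin.snoc_castSucc, Fin.snoc_last,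
        Fin.succ_last, Fin.succ_castSucc, Fin.val_castSucc, Fin.val_last]
      ring
    simp only [this]
    rw [Finset.sum_comm]
    simp only [Finset.mul_sum]
    rw [Finset.sum_comm' (t' := Finset.univ) (s' := fun _ => Finset.univ) (by simp)]
    rw [Finset.sum_comm]
    simp only [Finset.sum_comm (s := (Finset.univ : Finset S)) (t := (Finset.univ : Finset (Fin n → A)))]
    rw [Finset.sum_comm]

lemma path_sum_one {S A : Type*} [Fintype S] [Fintype A] [DecidableEq S] (s₁ : S)
    (G : ℕ → S → A → S → ℝ) (H : ℕ) :
    (∑ τ : (Fin (H + 1) → S) × (Fin H → A),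
      ((if τ.1 0 = s₁ then 1 else 0) *
        ∏ h : Fin H, G h (τ.1 h.castSucc) (τ.2 h) (τ.1 h.succ)))
      = ∑ x, visit s₁ (fun _ _ _ => 1) G H x := by
  simpa using path_sum s₁ G H (fun _ => 1)

lemma visit_mass {X A : Type*} [Fintype X] [Fintype A] [DecidableEq X] (s₁ : X)
    (π : ℕ → X → A → ℝ) (P : ℕ → X → A → X → ℝ) (n : ℕ)
    (hP : ∀ x, ∑ a, ∑ x', π n x a * P n x a x' = 1) :
    ∑ x, visit s₁ π P (n+1) x = ∑ x, visit s₁ π P n x := by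
  simp only [visit]
  rw [Finset.sum_comm]
  refine Finset.sum_congr rfl fun x _ => ?_
  rw [Finset.sum_comm]
  simp only [mul_assoc, ← Finset.mul_sum]
  simp only [Finset.mul_sum] at hP ⊢
  simp only [← Finset.mul_sum] at hP ⊢
  rw [hP, mul_one]

lemma visit_mass_le {X A : Type*} [Fintype X] [Fintype A] [DecidableEq X] (s₁ : X)
    (π : ℕ → X → A → ℝ) (P : ℕ → X → A → X → ℝ) (m H : ℕ) (hm : m ≤ H)
    (hP : ∀ n, m ≤ n → n < H → ∀ x, ∑ a, ∑ x', π n x a * P n x a x' = 1) :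
    ∑ x, visit s₁ π P H x = ∑ x, visit s₁ π P m x := by
  induction H, hm using Nat.le_induction with
  | base => rfl
  | succ k hk ih =>
    rw [visit_mass _ _ _ _ (hP k hk (by omega)), ih fun n h1 h2 => hP n h1 (by omega)]

open Classical in
lemma visit_absorb {S A : Type*} [Fintype S] [Fintype A] [DecidableEq S] (s₁ : S)
    (P : ℕ → S → A → S → ℝ) (F : Set (ℕ × S × A × S))
    (π : ℕ → S → A → ℝ) (πe : ℕ → S ⊕ Unit → A → ℝ)
    (hπe : ∀ h s, πe h (Sum.inl s) = π h s) (G : ℕ → S → A → S → ℝ) (n : ℕ)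
    (hG : ∀ k < n, ∀ s a s', G k s a s' =
      if (k, s, a, s') ∈ F then 0 else π k s a * P k s a s') (s : S) :
    visit (Sum.inl s₁) πe (absorb P F) n (Sum.inl s) = visit s₁ (fun _ _ _ => 1) G n s := by
  induction n generalizing s with
  | zero => simp [visit]
  | succ n ih =>
    have ih' := ih fun k hk => hG k (by omega)
    simp only [visit, Fintype.sum_sum_type, ih', hπe, absorb, hG n (by omega)]
    simp only [mul_zero, Finset.sum_const_zero, add_zero]
    refine Finset.sum_congr rfl fun x _ => Finset.sum_congr rfl fun a _ => ?_
    split_ifs <;> ring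

open Classical in
/-- the probability under `(π,P)` of first entering a tuple of
`F` exactly at step `h` equals
`∑_{s,a} d^{π,P̃}_h(s) π_h(a|s) P̃_h(s†|s,a)`, and consequently the probability
that the trajectory ever contains a tuple of `F` equals `d^{π,P̃}_{H+1}(s†)`. -/
theorem stmt_10 {S A : Type*} [Fintype S] [Fintype A] [DecidableEq S]
    [Nonempty S] [Nonempty A]
    (H : ℕ) (hH : 1 ≤ H) (s₁ : S)
    (P : ℕ → S → A → S → ℝ)
    (hPnn : ∀ h < H, ∀ s a s', 0 ≤ P h s a s')
    (hPsum : ∀ h < H, ∀ s a, ∑ s', P h s a s' = 1)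
    (F : Set (ℕ × S × A × S))
    (π : ℕ → S → A → ℝ)
    (hπnn : ∀ h < H, ∀ s a, 0 ≤ π h s a)
    (hπsum : ∀ h < H, ∀ s, ∑ a, π h s a = 1)
    (πe : ℕ → S ⊕ Unit → A → ℝ)
    (hπe : ∀ h s, πe h (Sum.inl s) = π h s)
    (hπenn : ∀ h < H, ∀ a, 0 ≤ πe h (Sum.inr ()) a)
    (hπesum : ∀ h < H, ∑ a, πe h (Sum.inr ()) a = 1)
    (h : ℕ) (hh : h < H) :
    (∑ τ : (Fin (H + 1) → S) × (Fin H → A),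
        if ((h, τ.1 (⟨h, hh⟩ : Fin H).castSucc, τ.2 ⟨h, hh⟩,
              τ.1 (⟨h, hh⟩ : Fin H).succ) ∈ F ∧
            ∀ h' : Fin H, (h' : ℕ) < h →
              ((h' : ℕ), τ.1 h'.castSucc, τ.2 h', τ.1 h'.succ) ∉ F)
          then trajProb H s₁ π P τ else 0)
      = ∑ s : S, ∑ a : A,
          visit (Sum.inl s₁) πe (absorb P F) h (Sum.inl s) *
            πe h (Sum.inl s) a * absorb P F h (Sum.inl s) a (Sum.inr ()) ∧
    (∑ τ : (Fin (H + 1) → S) × (Fin H → A),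
        if (∃ h' : Fin H, ((h' : ℕ), τ.1 h'.castSucc, τ.2 h', τ.1 h'.succ) ∈ F)
          then trajProb H s₁ π P τ else 0)
      = visit (Sum.inl s₁) πe (absorb P F) H (Sum.inr ()) := by
  have hone : ∀ n < H, ∀ x, ∑ a, ∑ x', π n x a * P n x a x' = 1 := by
    intro n hn x
    simp only [← Finset.mul_sum, hPsum n hn, mul_one, hπsum n hn]
  constructor
  · let G : ℕ → S → A → S → ℝ := fun k s a s' =>
      if k < h then (if (k, s, a, s') ∈ F then 0 else π k s a * P k s a s')
      else if k = h then (if (k, s, a, s') ∈ F then π k s a * P k s a s' else 0)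
      else π k s a * P k s a s'
    have h1 : ∀ τ : (Fin (H + 1) → S) × (Fin H → A),
        (if ((h, τ.1 (⟨h, hh⟩ : Fin H).castSucc, τ.2 ⟨h, hh⟩,
              τ.1 (⟨h, hh⟩ : Fin H).succ) ∈ F ∧
            ∀ h' : Fin H, (h' : ℕ) < h →
              ((h' : ℕ), τ.1 h'.castSucc, τ.2 h', τ.1 h'.succ) ∉ F)
          then trajProb H s₁ π P τ else 0) =
        (if τ.1 0 = s₁ then 1 else 0) *
        ∏ h : Fin H, G h (τ.1 h.castSucc) (τ.2 h) (τ.1 h.succ) := by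
      intro τ
      split_ifs with hc h0 h0
      · rw [trajProb, if_pos h0]
        congr 1
        refine Finset.prod_congr rfl fun k _ => ?_
        rcases lt_trichotomy (k : ℕ) h with hk | hk | hk
        · simp only [G, if_pos hk, if_neg (hc.2 k hk)]
        · obtain rfl : k = ⟨h, hh⟩ := Fin.ext hk
          simp only [G, lt_irrefl, if_false, if_true, if_pos hc.1]
        · simp only [G, if_neg hk.not_gt, if_neg hk.ne']
      · simp [trajProb, h0]
      · rw [one_mul]
        symm
        rw [not_and_or] at hc
        rcases hc with hc | hc
        · refine Finset.prod_eq_zero (Finset.mem_univ ⟨h, hh⟩) ?_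
          simp only [G, lt_irrefl, if_false, if_true, if_neg hc]
        · push Not at hc
          obtain ⟨k, hk, hF⟩ := hc
          refine Finset.prod_eq_zero (Finset.mem_univ k) ?_
          simp only [G, if_pos hk, if_pos hF]
      · simp
    rw [Finset.sum_congr rfl fun τ _ => h1 τ, path_sum_one,
      visit_mass_le _ _ _ (h+1) H hh]
    · simp only [visit_absorb s₁ P F π πe hπe G h (fun k hk s a s' => by simp only [G, if_pos hk])]
      simp only [visit]
      rw [Finset.sum_comm]
      refine Finset.sum_congr rfl fun s _ => ?_
      rw [Finset.sum_comm]
      refine Finset.sum_congr rfl fun a _ => ?_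
      simp only [absorb, hπe, Finset.mul_sum]
      refine Finset.sum_congr rfl fun s' _ => ?_
      simp only [G, lt_irrefl, if_false, if_true]
      split_ifs <;> ring
    · intro n hn hnH x
      refine Eq.trans ?_ (hone n hnH x)
      refine Finset.sum_congr rfl fun a _ => Finset.sum_congr rfl fun x' _ => ?_
      simp only [G, if_neg (show ¬ n < h by omega), if_neg (show ¬ n = h by omega), one_mul]
  · let G : ℕ → S → A → S → ℝ := fun k s a s' =>
      if (k, s, a, s') ∈ F then 0 else π k s a * P k s a s'
    have h1 : ∀ τ : (Fin (H + 1) → S) × (Fin H → A),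
        (if (∃ h' : Fin H, ((h' : ℕ), τ.1 h'.castSucc, τ.2 h', τ.1 h'.succ) ∈ F)
          then trajProb H s₁ π P τ else 0) =
        (if τ.1 0 = s₁ then 1 else 0) *
          ∏ h : Fin H, (fun k s a s' => π k s a * P k s a s' : ℕ → S → A → S → ℝ)
            h (τ.1 h.castSucc) (τ.2 h) (τ.1 h.succ) -
        (if τ.1 0 = s₁ then 1 else 0) *
        ∏ h : Fin H, G h (τ.1 h.castSucc) (τ.2 h) (τ.1 h.succ) := by
      intro τ
      by_cases hc : ∃ h' : Fin H, ((h' : ℕ), τ.1 h'.castSucc, τ.2 h', τ.1 h'.succ) ∈ F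
      · rw [if_pos hc]
        obtain ⟨k, hk⟩ := hc
        rw [Finset.prod_eq_zero (f := fun h : Fin H =>
          G h (τ.1 h.castSucc) (τ.2 h) (τ.1 h.succ)) (Finset.mem_univ k)
          (by simp only [G, if_pos hk])]
        simp [trajProb]
      · rw [if_neg hc, eq_comm, sub_eq_zero]
        push Not at hc
        congr 1
        refine Finset.prod_congr rfl fun k _ => ?_
        simp only [G, if_neg (hc k)]
    rw [Finset.sum_congr rfl fun τ _ => h1 τ, Finset.sum_sub_distrib, path_sum_one s₁ G,
      path_sum_one s₁ (fun k s a s' => π k s a * P k s a s'),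
      visit_mass_le _ _ _ 0 H (Nat.zero_le _)
        (fun n _ hn x => by simpa only [one_mul] using hone n hn x)]
    have h2 : ∑ x, visit (Sum.inl s₁) πe (absorb P F) H x
        = ∑ x, visit (Sum.inl s₁) πe (absorb P F) 0 x := by
      refine visit_mass_le _ _ _ 0 H (Nat.zero_le _) ?_
      rintro n - hn (x | x)
      · refine Eq.trans ?_ (hone n hn x)
        refine Finset.sum_congr rfl fun a _ => ?_
        simp only [← Finset.mul_sum, hπe]
        congr 1
        simp only [Fintype.sum_sum_type, absorb, Finset.univ_unique, Finset.sum_singleton]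
        rw [← Finset.sum_add_distrib]
        refine Finset.sum_congr rfl fun s' _ => ?_
        split_ifs <;> simp
      · simpa [absorb] using hπesum n hn
    rw [Fintype.sum_sum_type] at h2
    simp only [visit_absorb s₁ P F π πe hπe G H (fun k hk s a s' => rfl)] at h2
    simp [visit] at h2 ⊢
    linarith
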